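/- Let ρ⁰ ∈ 𝒟_density, set ψ⁰_i(u) := ∫_0^u ρ⁰_i(u') du', and define ψ(u, t) := (Υ^{-1} ∘ θ_t ∘ Υ(ψ⁰))(u). Then each ψ_i belongs to C²(ℝ₊², ℝ₊), and ρ_i(u, t) := ∂_u ψ_i(u, t) satisfies: each ρ_i belongs to C¹(ℝ₊², ℝ₊); ρ(·, t) ∈ 𝒟_density for all t ≥ 0; and ρ solves the conservation-law system ∂_t ρ_i = − ∂_u (v_i^eff(ρ) ρ_i) on ℝ₊² for i = 1, …, I with ρ(·, 0) = ρ⁰. Moreover, ρ is the unique solution of this initial value problem in the class of functions ρ with each component in C¹(ℝ₊², ℝ₊) and satisfying ρ(·, t) ∈ 𝒟_density for all t ≥ 0. -/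

import Mathlib

open Set Filter

noncomputable section

/-- `f ∈ 𝒞`: continuous, non-decreasing, `ℝ₊`-valued on `ℝ₊`, with `f 0 = 0`. -/
def memC (f : ℝ → ℝ) : Prop :=
  ContinuousOn f (Ici 0) ∧ MonotoneOn f (Ici 0) ∧ f 0 = 0 ∧ ∀ u ∈ Ici (0:ℝ), 0 ≤ f u

/-- `f ∈ 𝒞^↑`: member of `𝒞` that is strictly increasing and tends to `∞` at `∞`. -/
def memCup (f : ℝ → ℝ) : Prop :=
  memC f ∧ StrictMonoOn f (Ici 0) ∧ Tendsto f atTop atTop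

/-- the soliton size associated with the index `i : Fin I`, namely `i+1`, as a real number. -/
def sz {I : ℕ} (i : Fin I) : ℝ := (i : ℕ) + 1

/-- the effective-distance (integrated slot density) function `φ_i`. -/
def phi {I : ℕ} (ψ : Fin I → ℝ → ℝ) (i : Fin I) (u : ℝ) : ℝ :=
  u - ∑ j, 2 * min (sz i) (sz j) * ψ j u

/-- the top effective-distance function `φ_I` (note `min (I, j) = j` for `j ≤ I`). -/
def phiTop {I : ℕ} (ψ : Fin I → ℝ → ℝ) (u : ℝ) : ℝ :=
  u - ∑ j, 2 * sz j * ψ j u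

/-- `ψ ∈ 𝓕`. -/
def memF {I : ℕ} (ψ : Fin I → ℝ → ℝ) : Prop :=
  (∀ i, memC (ψ i)) ∧ memCup (phiTop ψ)

/-- the inverse of `f : ℝ₊ → ℝ₊` (as a function `ℝ → ℝ` supported in domain `Ici 0`). -/
def rinv (f : ℝ → ℝ) : ℝ → ℝ := Function.invFunOn f (Ici 0)

/-- the effective scaling (scattering) map `Υ`. -/
def Upsilon {I : ℕ} (ψ : Fin I → ℝ → ℝ) : Fin I → ℝ → ℝ :=
  fun i => ψ i ∘ rinv (phi ψ i)

/-- `gammaK ψb k = γ_{I-k}`, defined by downward recursion from `γ_I = id`: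
`γ_i(z) = z + ∑_{j>i} 2(j-i) ψb_j (γ_j z)`. -/
def gammaK {I : ℕ} (ψb : Fin I → ℝ → ℝ) : ℕ → ℝ → ℝ
  | 0 => fun z => z
  | k + 1 => fun z =>
      z + ∑ m ∈ (Finset.range (k + 1)).attach,
        2 * (((k + 1 : ℕ) : ℝ) - ((m : ℕ) : ℝ)) *
          (if h : (m : ℕ) < I then
              ψb ⟨I - 1 - (m : ℕ), by omega⟩ (gammaK ψb (m : ℕ) z)
            else 0)
  termination_by k => k
  decreasing_by have hm := Finset.mem_range.mp m.2; omega

/-- `γ_i`, for `i = 0, 1, …, I`. -/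
def gam {I : ℕ} (ψb : Fin I → ℝ → ℝ) (i : ℕ) : ℝ → ℝ := gammaK ψb (I - i)

/-- the spatial reconstruction (inverse scattering) map `Γ`. -/
def Gamma {I : ℕ} (ψb : Fin I → ℝ → ℝ) : Fin I → ℝ → ℝ :=
  fun i => ψb i ∘ gam ψb ((i : ℕ) + 1) ∘ rinv (gam ψb 0)

/-- the free-evolution shift `θ_t`. -/
def theta {I : ℕ} (t : ℝ) (ψb : Fin I → ℝ → ℝ) : Fin I → ℝ → ℝ :=
  fun i z => ψb i (max (z - sz i * t) 0)

/-- `ψ ∈ 𝒟`: member of `𝓕` satisfying the density condition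
`∑_i i · sup_{u₁≠u₂} (ψ_i(u₁)-ψ_i(u₂))/(φ_i(u₁)-φ_i(u₂)) < 1/2`. -/
def memD {I : ℕ} (ψ : Fin I → ℝ → ℝ) : Prop :=
  memF ψ ∧
  ∃ c : Fin I → ℝ,
    (∀ i, ∀ u₁ ∈ Ici (0:ℝ), ∀ u₂ ∈ Ici (0:ℝ), u₂ < u₁ →
      ψ i u₁ - ψ i u₂ ≤ c i * (phi ψ i u₁ - phi ψ i u₂)) ∧
    ∑ i, sz i * c i < 1 / 2

/-- `ψb ∈ 𝒟̄`: member of `𝒞^I` satisfying the density condition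
`∑_i i · sup_{z₁≠z₂} (ψb_i(z₁)-ψb_i(z₂))/(z₁-z₂) < 1/2`. -/
def memDbar {I : ℕ} (ψb : Fin I → ℝ → ℝ) : Prop :=
  (∀ i, memC (ψb i)) ∧
  ∃ c : Fin I → ℝ,
    (∀ i, ∀ z₁ ∈ Ici (0:ℝ), ∀ z₂ ∈ Ici (0:ℝ), z₂ < z₁ →
      ψb i z₁ - ψb i z₂ ≤ c i * (z₁ - z₂)) ∧
    ∑ i, sz i * c i < 1 / 2

/-- the extension `f^ℝ` of `f` to `ℝ`, by `0` on the negative half-line. -/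
def extZ (f : ℝ → ℝ) : ℝ → ℝ := fun u => if 0 ≤ u then f u else 0

/-- the extension `f^{ℝ,↑}` of `f` to `ℝ`, by the identity on the negative half-line. -/
def extId (f : ℝ → ℝ) : ℝ → ℝ := fun u => if 0 ≤ u then f u else u

/-- `f ∈ 𝒞^q`. -/
def memCq (q : ℕ) (f : ℝ → ℝ) : Prop := memC f ∧ ContDiff ℝ q (extZ f)

/-- `f ∈ 𝒞^{↑,q}`. -/
def memCupq (q : ℕ) (f : ℝ → ℝ) : Prop := memCup f ∧ ContDiff ℝ q (extId f)

/-- `f ∈ C^q(ℝ₊², ℝ₊)`: `ℝ₊`-valued and `q`-times continuously differentiable on the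
quadrant (one-sided at the boundary). -/
def memCqTwo (q : ℕ) (f : ℝ → ℝ → ℝ) : Prop :=
  (∀ u ∈ Ici (0:ℝ), ∀ t ∈ Ici (0:ℝ), 0 ≤ f u t) ∧
  ContDiffOn ℝ q (fun p : ℝ × ℝ => f p.1 p.2) (Ici 0 ×ˢ Ici 0)

/-- the matrix `M(ρ)`. -/
def Mmat {I : ℕ} (ρ : Fin I → ℝ) : Matrix (Fin I) (Fin I) ℝ :=
  Matrix.of fun i j =>
    if i = j then 1 - ∑ k ∈ Finset.univ.erase i, 2 * min (sz i) (sz k) * ρ k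
    else 2 * min (sz i) (sz j) * ρ j

/-- the effective speeds `v^eff(ρ) = M(ρ)⁻¹ v`, where `v_i = i`. -/
def veff {I : ℕ} (ρ : Fin I → ℝ) : Fin I → ℝ :=
  ((Mmat ρ)⁻¹).mulVec fun i => sz i

/-- `ρ ∈ 𝒟_density`. -/
def memDdensity {I : ℕ} (ρ : Fin I → ℝ → ℝ) : Prop :=
  (∀ i, (∀ u ∈ Ici (0:ℝ), 0 ≤ ρ i u) ∧ ContDiff ℝ 1 (extZ (ρ i))) ∧
  (∀ u ∈ Ici (0:ℝ), ∑ i, 2 * sz i * ρ i u < 1) ∧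
  ∃ c : Fin I → ℝ,
    (∀ i, ∀ u ∈ Ici (0:ℝ),
      ρ i u ≤ c i * (1 - ∑ j, 2 * min (sz i) (sz j) * ρ j u)) ∧
    ∑ i, sz i * c i < 1 / 2

lemma sz_pos {I : ℕ} (i : Fin I) : 0 < sz i := by unfold sz; positivity

lemma min_sz_nonneg {I : ℕ} (i j : Fin I) : 0 ≤ min (sz i) (sz j) :=
  (lt_min (sz_pos i) (sz_pos j)).le

lemma min_sz_eq_sum {I : ℕ} (i j : Fin I) :
    min (sz i) (sz j) = ∑ k : Fin I, (if k ≤ i then (1:ℝ) else 0) * (if k ≤ j then 1 else 0) := by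
  have h : min (sz i) (sz j) = sz (min i j) := by
    unfold sz
    rcases le_total i j with h | h
    · have : ((i : ℕ) : ℝ) ≤ (j : ℕ) := by exact_mod_cast h
      simp [h, this]
    · have : ((j : ℕ) : ℝ) ≤ (i : ℕ) := by exact_mod_cast h
      simp [h, this]
  have h2 : ∀ k : Fin I, (if k ≤ i then (1:ℝ) else 0) * (if k ≤ j then 1 else 0)
      = if k ∈ Finset.Iic (min i j) then 1 else 0 := by
    intro k
    simp only [Finset.mem_Iic, le_min_iff]
    split_ifs <;> simp_all
  rw [h, Finset.sum_congr rfl fun k _ => h2 k]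
  rw [Finset.sum_boole, Finset.filter_mem_eq_inter, Finset.univ_inter, Fin.card_Iic]
  simp [sz]

lemma quad_min_eq {I : ℕ} (x : Fin I → ℝ) :
    ∑ i, x i * ∑ j, min (sz i) (sz j) * x j = ∑ k, (∑ i, if k ≤ i then x i else 0) ^ 2 := by
  have h : ∀ k, (∑ i, if k ≤ i then x i else 0) ^ 2
      = ∑ i, ∑ j, x i * ((if k ≤ i then (1:ℝ) else 0) * (if k ≤ j then 1 else 0)) * x j := by
    intro k
    rw [sq, Finset.sum_mul_sum]
    refine Finset.sum_congr rfl fun i _ => Finset.sum_congr rfl fun j _ => ?_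
    split_ifs <;> simp
  simp only [h]
  rw [Finset.sum_comm]
  refine Finset.sum_congr rfl fun i _ => ?_
  rw [Finset.sum_comm, Finset.mul_sum]
  refine Finset.sum_congr rfl fun j _ => ?_
  rw [min_sz_eq_sum, ← Finset.sum_mul, ← Finset.mul_sum]
  ring

/-- The kernel `min (sz i) (sz j)` is positive definite. -/
lemma eq_zero_of_quad_min_nonpos {I : ℕ} (x : Fin I → ℝ)
    (h : ∑ i, x i * ∑ j, min (sz i) (sz j) * x j ≤ 0) : x = 0 := by
  rw [quad_min_eq] at h
  have h0 : ∀ k, (∑ i, if k ≤ i then x i else 0) = 0 := by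
    have := (Finset.sum_eq_zero_iff_of_nonneg (fun k _ => sq_nonneg _)).1
      (le_antisymm h (Finset.sum_nonneg fun k (_ : k ∈ Finset.univ) =>
        sq_nonneg (∑ i, if k ≤ i then x i else 0)))
    intro k
    simpa using this k (Finset.mem_univ k)
  funext k
  induction k using WellFoundedGT.induction with
  | _ k ih =>
    have := h0 k
    rw [Finset.sum_eq_single k] at this
    · simpa using this
    · intro b _ hb
      split_ifs with hkb
      · exact ih b (lt_of_le_of_ne hkb (Ne.symm hb))
      · rfl
    · simp

/-- The values of densities for which the effective speed is well defined. -/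
def Admissible {I : ℕ} (ρ : Fin I → ℝ) : Prop :=
  (∀ i, 0 ≤ ρ i) ∧ ∑ i, 2 * sz i * ρ i < 1

lemma Admissible.pos {I : ℕ} {ρ : Fin I → ℝ} (h : Admissible ρ) (i : Fin I) :
    0 < 1 - ∑ j, 2 * min (sz i) (sz j) * ρ j := by
  have : ∑ j, 2 * min (sz i) (sz j) * ρ j ≤ ∑ j, 2 * sz j * ρ j := by
    refine Finset.sum_le_sum fun j _ => ?_
    have := h.1 j
    gcongr
    exact min_le_right _ _
  linarith [h.2]

lemma Mmat_mulVec {I : ℕ} (ρ w : Fin I → ℝ) (i : Fin I) :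
    (Mmat ρ).mulVec w i = (1 - ∑ j, 2 * min (sz i) (sz j) * ρ j) * w i
      + ∑ j, 2 * min (sz i) (sz j) * ρ j * w j := by
  unfold Matrix.mulVec dotProduct Mmat
  simp only [Matrix.of_apply]
  rw [← Finset.add_sum_erase _ _ (Finset.mem_univ i),
    ← Finset.add_sum_erase (a := i) _ (fun j => 2 * min (sz i) (sz j) * ρ j) (Finset.mem_univ i),
    ← Finset.add_sum_erase (a := i) _ (fun j => 2 * min (sz i) (sz j) * ρ j * w j)
      (Finset.mem_univ i)]
  have : ∑ x ∈ Finset.univ.erase i,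
      (if i = x then 1 - ∑ k ∈ Finset.univ.erase i, 2 * min (sz i) (sz k) * ρ k
        else 2 * min (sz i) (sz x) * ρ x) * w x
      = ∑ x ∈ Finset.univ.erase i, 2 * min (sz i) (sz x) * ρ x * w x := by
    refine Finset.sum_congr rfl fun j hj => ?_
    rw [if_neg (Finset.ne_of_mem_erase hj).symm]
  rw [this]
  simp only [if_true]
  ring

lemma Mmat_mulVec_eq_zero {I : ℕ} {ρ w : Fin I → ℝ} (h : Admissible ρ)
    (hw : (Mmat ρ).mulVec w = 0) : w = 0 := by
  have h1 : ∀ i, (1 - ∑ j, 2 * min (sz i) (sz j) * ρ j) * w i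
      + ∑ j, 2 * min (sz i) (sz j) * ρ j * w j = 0 := by
    intro i
    rw [← Mmat_mulVec, hw]; rfl
  have h2 : ∀ i : Fin I, ∑ j, 2 * min (sz i) (sz j) * ρ j * w j
      = 2 * ∑ j, min (sz i) (sz j) * (ρ j * w j) := by
    intro i
    rw [Finset.mul_sum]
    exact Finset.sum_congr rfl fun j _ => by ring
  have h3 : (fun i => ρ i * w i) = 0 := by
    apply eq_zero_of_quad_min_nonpos
    refine Finset.sum_nonpos fun i _ => ?_
    have e : ρ i * w i * ∑ j, min (sz i) (sz j) * (ρ j * w j)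
        = - (1 / 2 * ((1 - ∑ j, 2 * min (sz i) (sz j) * ρ j) * (ρ i * w i ^ 2))) := by
      have := h1 i
      rw [h2] at this
      linear_combination (ρ i * w i / 2) * this
    rw [e]
    have := h.pos i
    have := h.1 i
    have : 0 ≤ (1 - ∑ j, 2 * min (sz i) (sz j) * ρ j) * (ρ i * w i ^ 2) := by positivity
    linarith
  funext i
  have := h1 i
  rw [h2] at this
  have h4 : ∑ j, min (sz i) (sz j) * (ρ j * w j) = 0 :=
    Finset.sum_eq_zero fun j _ => by rw [show ρ j * w j = 0 from congrFun h3 j, mul_zero]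
  rw [h4, mul_zero, add_zero] at this
  exact (mul_eq_zero.1 this).resolve_left (h.pos i).ne'

lemma isUnit_det_Mmat {I : ℕ} {ρ : Fin I → ℝ} (h : Admissible ρ) : IsUnit (Mmat ρ).det := by
  rw [isUnit_iff_ne_zero]
  intro h0
  obtain ⟨v, hv, hv0⟩ := Matrix.exists_mulVec_eq_zero_iff.2 h0
  exact hv (Mmat_mulVec_eq_zero h hv0)

lemma veff_spec {I : ℕ} {ρ : Fin I → ℝ} (h : Admissible ρ) (i : Fin I) :
    (1 - ∑ j, 2 * min (sz i) (sz j) * ρ j) * veff ρ i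
      + ∑ j, 2 * min (sz i) (sz j) * ρ j * veff ρ j = sz i := by
  rw [← Mmat_mulVec]
  unfold veff
  rw [Matrix.mulVec_mulVec, Matrix.mul_nonsing_inv _ (isUnit_det_Mmat h), Matrix.one_mulVec]

lemma eq_veff {I : ℕ} {ρ w : Fin I → ℝ} (h : Admissible ρ)
    (hw : ∀ i, (1 - ∑ j, 2 * min (sz i) (sz j) * ρ j) * w i
      + ∑ j, 2 * min (sz i) (sz j) * ρ j * w j = sz i) : w = veff ρ := by
  have : (Mmat ρ).mulVec w = fun i => sz i := funext fun i => by rw [Mmat_mulVec, hw]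
  unfold veff
  rw [← this, Matrix.mulVec_mulVec, Matrix.nonsing_inv_mul _ (isUnit_det_Mmat h),
    Matrix.one_mulVec]

lemma contDiff_det {E : Type*} [NormedAddCommGroup E] [NormedSpace ℝ E] {I : ℕ}
    {A : E → Matrix (Fin I) (Fin I) ℝ} (hA : ∀ i j, ContDiff ℝ 1 fun x => A x i j) :
    ContDiff ℝ 1 fun x => (A x).det := by
  simp only [Matrix.det_apply']
  exact ContDiff.sum fun σ _ => contDiff_const.mul (contDiff_prod fun i _ => hA _ _)

lemma contDiff_Mmat {I : ℕ} (i j : Fin I) : ContDiff ℝ 1 fun ρ : Fin I → ℝ => Mmat ρ i j := by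
  unfold Mmat
  simp only [Matrix.of_apply]
  split_ifs <;> fun_prop

lemma veff_eq_cramer {I : ℕ} (ρ : Fin I → ℝ) (i : Fin I) :
    veff ρ i = (Mmat ρ).det⁻¹ * ((Mmat ρ).updateCol i fun k => sz k).det := by
  unfold veff
  rw [Matrix.inv_def, Matrix.smul_mulVec, Pi.smul_apply, ← Matrix.cramer_eq_adjugate_mulVec,
    Matrix.cramer_apply, Ring.inverse_eq_inv', smul_eq_mul]

lemma contDiffAt_veff {I : ℕ} {ρ : Fin I → ℝ} (h : Admissible ρ) (i : Fin I) :
    ContDiffAt ℝ 1 (fun ρ => veff ρ i) ρ := by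
  simp only [veff_eq_cramer]
  refine ContDiffAt.mul (ContDiffAt.inv (contDiff_det contDiff_Mmat).contDiffAt
    (isUnit_det_Mmat h).ne_zero) (contDiff_det fun k l => ?_).contDiffAt
  by_cases hl : l = i
  · subst hl; simpa using contDiff_const
  · simpa [Matrix.updateCol_apply, hl] using contDiff_Mmat k l

lemma continuous_of_implicit {X : Type*} [TopologicalSpace X] {f : ℝ → X → ℝ}
    (hf : Continuous fun p : ℝ × X => f p.1 p.2) (hmono : ∀ x, StrictMono fun u => f u x)
    {U g : X → ℝ} (hg : Continuous g) (hU : ∀ x, f (U x) x = g x) : Continuous U := by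
  rw [continuous_iff_continuousAt]
  intro x
  have hcont : ∀ u, Continuous fun x => f u x := fun u =>
    hf.comp (continuous_const.prodMk continuous_id)
  rw [ContinuousAt, tendsto_order]
  constructor
  · intro a ha
    have h1 : f a x < g x := by rw [← hU]; exact hmono x ha
    filter_upwards [(hcont a).continuousAt.eventually_lt hg.continuousAt h1] with y hy
    rw [← hU] at hy
    exact (hmono y).lt_iff_lt.1 hy
  · intro a ha
    have h1 : g x < f a x := by rw [← hU]; exact hmono x ha
    filter_upwards [hg.continuousAt.eventually_lt (hcont a).continuousAt h1] with y hy
    rw [← hU] at hy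
    exact (hmono y).lt_iff_lt.1 hy

lemma clm_prod_apply (L : ℝ × ℝ →L[ℝ] ℝ) (a b : ℝ) : L (a, b) = a * L (1, 0) + b * L (0, 1) := by
  have : ((a, b) : ℝ × ℝ) = a • ((1, 0) : ℝ × ℝ) + b • ((0, 1) : ℝ × ℝ) := by simp
  rw [this, map_add, map_smul, map_smul, smul_eq_mul, smul_eq_mul]

/-- The derivative `x ↦ (L x, x.2)` of a graph-like map of the plane, as an equivalence. -/
def graphEquiv (L : ℝ × ℝ →L[ℝ] ℝ) (hL : L (1, 0) ≠ 0) : (ℝ × ℝ) ≃L[ℝ] (ℝ × ℝ) :=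
  ContinuousLinearEquiv.equivOfInverse (L.prod (ContinuousLinearMap.snd ℝ ℝ ℝ))
    (((L (1, 0))⁻¹ • (ContinuousLinearMap.fst ℝ ℝ ℝ
      - L (0, 1) • ContinuousLinearMap.snd ℝ ℝ ℝ)).prod (ContinuousLinearMap.snd ℝ ℝ ℝ))
    (by
      rintro ⟨a, b⟩
      simp only [ContinuousLinearMap.prod_apply, clm_prod_apply L a b]
      ext
      · simp; field_simp; ring
      · simp)
    (by
      rintro ⟨a, b⟩
      ext
      · simp [clm_prod_apply L ((L (1, 0))⁻¹ * (a - L (0, 1) * b)) b]; field_simp; ring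
      · simp)

lemma hasDerivAt_implicit {f : ℝ × ℝ → ℝ} {U : ℝ → ℝ → ℝ} (hU : ∀ y s, f (U y s, s) = y)
    (hc : Continuous fun p : ℝ × ℝ => U p.1 p.2) {y s : ℝ} {L : ℝ × ℝ →L[ℝ] ℝ}
    (hf : HasFDerivAt f L (U y s, s)) (hL : L (1, 0) ≠ 0) :
    HasDerivAt (fun s => U y s) (-L (0, 1) / L (1, 0)) s := by
  have h1 : HasFDerivAt (fun p : ℝ × ℝ => (f p, p.2))
      (graphEquiv L hL : ℝ × ℝ →L[ℝ] ℝ × ℝ) ((fun p : ℝ × ℝ => (U p.1 p.2, p.2)) (y, s)) :=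
    hf.prodMk hasFDerivAt_snd
  have h2 := h1.of_local_left_inverse (a := (y, s)) (hc.prodMk continuous_snd).continuousAt
    (Eventually.of_forall fun p => by simp [hU])
  have h3 : HasDerivAt (fun s : ℝ => ((y, s) : ℝ × ℝ)) (0, 1) s :=
    (hasDerivAt_const s y).prodMk (hasDerivAt_id s)
  have h4 := (h2.comp_hasDerivAt s h3)
  have h5 := hasFDerivAt_fst.comp_hasDerivAt (𝕜 := ℝ) s h4
  refine (h5.congr_deriv ?_)
  simp [graphEquiv, ContinuousLinearEquiv.symm_equivOfInverse]
  field_simp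

lemma contDiff_implicit {n : WithTop ℕ∞} (hn : n ≠ 0) {f : ℝ × ℝ → ℝ} (hf : ContDiff ℝ n f)
    (hmono : ∀ s, StrictMono fun u => f (u, s)) (hpos : ∀ p, fderiv ℝ f p (1, 0) ≠ 0)
    {U : ℝ → ℝ → ℝ} (hU : ∀ y s, f (U y s, s) = y) :
    ContDiff ℝ n fun p : ℝ × ℝ => U p.1 p.2 := by
  have hc : Continuous fun p : ℝ × ℝ => U p.1 p.2 :=
    continuous_of_implicit (X := ℝ × ℝ) (f := fun u p => f (u, p.2))
      (hf.continuous.comp (by fun_prop)) (fun p => hmono p.2) (g := fun p => p.1)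
      continuous_fst fun p => hU _ _
  let e : ℝ × ℝ ≃ₜ ℝ × ℝ :=
    { toFun := fun p => (f p, p.2)
      invFun := fun p => (U p.1 p.2, p.2)
      left_inv := fun p => Prod.ext ((hmono p.2).injective (hU _ _)) rfl
      right_inv := fun p => Prod.ext (hU _ _) rfl
      continuous_toFun := hf.continuous.prodMk continuous_snd
      continuous_invFun := hc.prodMk continuous_snd }
  have h := e.contDiff_symm (n := n) (𝕜 := ℝ) (f₀' := fun p => graphEquiv (fderiv ℝ f p) (hpos p))
    (fun p => ((hf.differentiable hn p).hasFDerivAt).prodMk hasFDerivAt_snd)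
    (hf.prodMk contDiff_snd)
  exact contDiff_fst.comp h

lemma gammaK_succ_eq {I : ℕ} (ψb : Fin I → ℝ → ℝ) (k : ℕ) (hk : k < I) (z : ℝ) :
    gammaK ψb (k + 1) z = z + ∑ m : Fin I,
      2 * ((k + 1 : ℝ) - min (k + 1 : ℝ) (m : ℕ)) * ψb m.rev (gammaK ψb (m : ℕ) z) := by
  rw [gammaK]
  let g : ℕ → ℝ := fun m => 2 * (((k + 1 : ℕ) : ℝ) - (m : ℝ)) *
    (if h : m < I then ψb ⟨I - 1 - m, by omega⟩ (gammaK ψb m z) else 0)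
  let g' : ℕ → ℝ := fun m => 2 * ((k + 1 : ℝ) - min (k + 1 : ℝ) (m : ℝ)) *
    (if h : m < I then ψb ⟨I - 1 - m, by omega⟩ (gammaK ψb m z) else 0)
  have h1 := Finset.sum_attach (Finset.range (k + 1)) g
  have h2 := Fin.sum_univ_eq_sum_range g' I
  have h3 : ∑ m ∈ Finset.range (k + 1), g m = ∑ m ∈ Finset.range I, g' m := by
    rw [← Finset.sum_subset (Finset.range_mono (Nat.succ_le_of_lt hk))]
    · refine Finset.sum_congr rfl fun m hm => ?_
      have : (m : ℝ) ≤ k + 1 := by exact_mod_cast (Finset.mem_range.1 hm).le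
      simp only [g, g', min_eq_right this]
      push_cast
      rfl
    · intro m _ hm
      have : (k + 1 : ℝ) ≤ m := by
        exact_mod_cast not_lt.1 fun h => hm (Finset.mem_range.2 h)
      simp only [g', min_eq_left this]
      simp
  refine congrArg (z + ·) ?_
  refine h1.trans (h3.trans (h2.symm.trans ?_))
  refine Finset.sum_congr rfl fun m _ => ?_
  have hr : (⟨I - 1 - (m : ℕ), by omega⟩ : Fin I) = m.rev := by
    ext; simp [Fin.val_rev]; omega
  simp only [g', m.2, dif_pos, hr]

lemma gam_eq {I : ℕ} (ψb : Fin I → ℝ → ℝ) {i : ℕ} (hi : i ≤ I) (z : ℝ) :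
    gam ψb i z = z + ∑ j : Fin I,
      2 * (sz j - min (i : ℝ) (sz j)) * ψb j (gam ψb ((j : ℕ) + 1) z) := by
  rcases hi.eq_or_lt with rfl | hi
  · have : ∀ j : Fin i, min (i : ℝ) (sz j) = sz j := fun j =>
      min_eq_right (by unfold sz; exact_mod_cast j.2)
    simp [this, gam, gammaK]
  · obtain ⟨k, hk⟩ : ∃ k, I - i = k + 1 := ⟨I - i - 1, by omega⟩
    unfold gam
    rw [hk, gammaK_succ_eq ψb k (by omega)]
    congr 1
    rw [← Equiv.sum_comp Fin.revPerm]
    refine Finset.sum_congr rfl fun j _ => ?_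
    have e1 : I - (((Fin.revPerm j).rev : ℕ) + 1) = (Fin.revPerm j : ℕ) := by
      simp only [Fin.revPerm_apply, Fin.rev_rev, Fin.val_rev]
    have e2 : (Fin.revPerm j).rev = j := by simp
    rw [e2] at e1 ⊢
    rw [e1]
    congr 2
    have e3 : ((Fin.revPerm j : ℕ) : ℝ) = I - (j + 1) := by
      rw [← e1, Nat.cast_sub (by omega)]; push_cast; ring
    have e4 : (k + 1 : ℝ) = I - i := by
      rw [← Nat.cast_sub hi.le, hk]; push_cast; ring
    rw [e3, e4]
    unfold sz
    rcases le_total (i : ℝ) (j + 1) with h | h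
    · rw [min_eq_left h, min_eq_right (by linarith)]; ring
    · rw [min_eq_right h, min_eq_left (by linarith)]; ring

lemma gam_zero_eq {I : ℕ} (ψb : Fin I → ℝ → ℝ) (z : ℝ) :
    gam ψb 0 z = z + ∑ j : Fin I, 2 * sz j * ψb j (gam ψb ((j : ℕ) + 1) z) := by
  rw [gam_eq ψb (Nat.zero_le _)]
  congr 1
  refine Finset.sum_congr rfl fun j _ => ?_
  rw [Nat.cast_zero, min_eq_left (sz_pos j).le, sub_zero]

lemma gam_succ_eq {I : ℕ} (ψb : Fin I → ℝ → ℝ) (i : Fin I) (z : ℝ) :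
    gam ψb ((i : ℕ) + 1) z = gam ψb 0 z
      - ∑ j : Fin I, 2 * min (sz i) (sz j) * ψb j (gam ψb ((j : ℕ) + 1) z) := by
  rw [gam_eq ψb (Nat.succ_le_of_lt i.2), gam_zero_eq, add_sub_assoc, ← Finset.sum_sub_distrib]
  congr 1
  refine Finset.sum_congr rfl fun j _ => ?_
  simp only [sz]
  push_cast
  ring

lemma gam_induction {I : ℕ} {P : ℕ → Prop}
    (h : ∀ i ≤ I, (∀ j : Fin I, i ≤ (j : ℕ) → P ((j : ℕ) + 1)) → P i) : ∀ i ≤ I, P i := by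
  intro i hi
  induction hk : I - i using Nat.strong_induction_on generalizing i with
  | _ k ih =>
    exact h i hi fun j hj => ih (I - (j + 1)) (by omega) _ (by omega) rfl

/-- The recursion for `gam` only involves the indices above `i`. -/
lemma gam_eq_filter {I : ℕ} (ψb : Fin I → ℝ → ℝ) {i : ℕ} (hi : i ≤ I) (z : ℝ) :
    gam ψb i z = z + ∑ j ∈ Finset.univ.filter (fun j : Fin I => i ≤ (j : ℕ)),
      2 * (sz j - i) * ψb j (gam ψb ((j : ℕ) + 1) z) := by
  rw [gam_eq ψb hi, Finset.sum_filter]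
  congr 1
  refine Finset.sum_congr rfl fun j _ => ?_
  split_ifs with h
  · have : (i : ℝ) ≤ sz j := by unfold sz; exact_mod_cast h.trans (Nat.le_succ _)
    rw [min_eq_left this]
  · have : sz j ≤ (i : ℝ) := by unfold sz; exact_mod_cast not_le.1 h
    rw [min_eq_right this]; ring

lemma monotone_gam_sub {I : ℕ} {ψb : Fin I → ℝ → ℝ} (hψ : ∀ j, Monotone (ψb j)) :
    ∀ i ≤ I, Monotone fun z => gam ψb i z - z := by
  refine gam_induction fun i hi ih => ?_
  have hg : ∀ j : Fin I, i ≤ (j : ℕ) → Monotone (gam ψb ((j : ℕ) + 1)) := fun j hj => by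
    have := (ih j hj).add monotone_id
    simpa [Pi.add_def] using this
  intro z z' hz
  simp only [gam_eq_filter ψb hi, add_sub_cancel_left]
  refine Finset.sum_le_sum fun j hj => ?_
  have hj := (Finset.mem_filter.1 hj).2
  have h1 : (i : ℝ) ≤ sz j := by unfold sz; exact_mod_cast hj.trans (Nat.le_succ _)
  have h2 := hψ j (hg j hj hz)
  have h3 : 0 ≤ 2 * (sz j - i) := by linarith
  gcongr

lemma contDiff_gam {I : ℕ} {n : WithTop ℕ∞} {θ : ℝ → Fin I → ℝ → ℝ}
    (hθ : ∀ j, ContDiff ℝ n fun p : ℝ × ℝ => θ p.2 j p.1) :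
    ∀ i ≤ I, ContDiff ℝ n fun p : ℝ × ℝ => gam (θ p.2) i p.1 := by
  refine gam_induction fun i hi ih => ?_
  simp only [fun p : ℝ × ℝ => gam_eq_filter (θ p.2) hi p.1]
  refine contDiff_fst.add (ContDiff.sum fun j hj => ?_)
  have hj := (Finset.mem_filter.1 hj).2
  exact contDiff_const.mul ((hθ j).comp ((ih j hj).prodMk contDiff_snd))

/-- The mass `∫₀ᵘ ρ_i` of a density extended by zero to the negative half-line. -/
def mass {I : ℕ} (ρ : Fin I → ℝ → ℝ) (i : Fin I) (u : ℝ) : ℝ := ∫ x in (0:ℝ)..u, extZ (ρ i) x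

lemma extZ_of_nonneg (f : ℝ → ℝ) {u : ℝ} (hu : 0 ≤ u) : extZ f u = f u := if_pos hu

lemma extZ_of_neg (f : ℝ → ℝ) {u : ℝ} (hu : u < 0) : extZ f u = 0 := if_neg (not_le.2 hu)

lemma integral_extZ (f : ℝ → ℝ) {u : ℝ} (hu : 0 ≤ u) :
    ∫ x in (0:ℝ)..u, extZ f x = ∫ x in (0:ℝ)..u, f x := by
  refine intervalIntegral.integral_congr fun x hx => ?_
  rw [uIcc_of_le hu] at hx
  exact extZ_of_nonneg f hx.1

lemma mass_zero {I : ℕ} (ρ : Fin I → ℝ → ℝ) (i : Fin I) : mass ρ i 0 = 0 :=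
  intervalIntegral.integral_same

lemma phi_mass_zero {I : ℕ} (ρ : Fin I → ℝ → ℝ) (i : Fin I) : phi (mass ρ) i 0 = 0 := by
  simp [phi, mass_zero]

namespace memDdensity

variable {I : ℕ} {ρ : Fin I → ℝ → ℝ}

lemma continuous_extZ (h : memDdensity ρ) (i : Fin I) : Continuous (extZ (ρ i)) :=
  (h.1 i).2.continuous

lemma apply_zero (h : memDdensity ρ) (i : Fin I) : ρ i 0 = 0 := by
  have h1 : Tendsto (extZ (ρ i)) (nhdsWithin 0 (Iio 0)) (nhds (extZ (ρ i) 0)) :=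
    (h.continuous_extZ i).continuousAt.mono_left nhdsWithin_le_nhds
  have h2 : Tendsto (extZ (ρ i)) (nhdsWithin 0 (Iio 0)) (nhds 0) :=
    tendsto_const_nhds.congr' <| by
      filter_upwards [self_mem_nhdsWithin] with x hx
      exact (extZ_of_neg _ hx).symm
  rw [← extZ_of_nonneg (ρ i) le_rfl]
  exact tendsto_nhds_unique h1 h2

lemma extZ_eq_max (h : memDdensity ρ) (i : Fin I) (u : ℝ) : extZ (ρ i) u = ρ i (max u 0) := by
  rcases le_total 0 u with hu | hu
  · rw [extZ_of_nonneg _ hu, max_eq_left hu]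
  · rw [max_eq_right hu, h.apply_zero]
    rcases hu.eq_or_lt with rfl | hu
    · rw [extZ_of_nonneg _ le_rfl, h.apply_zero]
    · rw [extZ_of_neg _ hu]

lemma admissible (h : memDdensity ρ) (u : ℝ) : Admissible fun i => extZ (ρ i) u := by
  simp only [h.extZ_eq_max]
  exact ⟨fun i => (h.1 i).1 _ (mem_Ici.2 (le_max_right _ _)), h.2.1 _ (mem_Ici.2 (le_max_right _ _))⟩

lemma exists_const (h : memDdensity ρ) : ∃ c : Fin I → ℝ, (∀ i, 0 ≤ c i) ∧
    (∀ i u, extZ (ρ i) u ≤ c i * (1 - ∑ j, 2 * min (sz i) (sz j) * extZ (ρ j) u)) ∧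
    ∑ i, sz i * c i < 1 / 2 := by
  obtain ⟨c, hc, hc2⟩ := h.2.2
  have key : ∀ i u, extZ (ρ i) u ≤ c i * (1 - ∑ j, 2 * min (sz i) (sz j) * extZ (ρ j) u) := by
    intro i u
    simp only [h.extZ_eq_max]
    exact hc i _ (mem_Ici.2 (le_max_right _ _))
  refine ⟨c, fun i => ?_, key, hc2⟩
  exact nonneg_of_mul_nonneg_left (((h.admissible 0).1 i).trans (key i 0)) ((h.admissible 0).pos i)

lemma exists_slot_density_le (h : memDdensity ρ) : ∃ δ > 0, ∀ (i : Fin I) (u : ℝ),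
    δ ≤ 1 - ∑ j, 2 * min (sz i) (sz j) * extZ (ρ j) u := by
  obtain ⟨c, hc0, hc, hc2⟩ := h.exists_const
  refine ⟨1 - 2 * ∑ j, sz j * c j, by linarith, fun i u => ?_⟩
  rw [Finset.mul_sum]
  refine sub_le_sub_left (Finset.sum_le_sum fun j _ => ?_) 1
  have h1 := (h.admissible u).1
  have h2 : extZ (ρ j) u ≤ c j := by
    refine (hc j u).trans (mul_le_of_le_one_right (hc0 j) (sub_le_self _ ?_))
    exact Finset.sum_nonneg fun k _ => mul_nonneg (mul_nonneg two_pos.le (min_sz_nonneg j k)) (h1 k)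
  calc 2 * min (sz i) (sz j) * extZ (ρ j) u ≤ 2 * sz j * c j := by
        have := h1 j
        have := sz_pos j
        gcongr
        exact min_le_right _ _
    _ = 2 * (sz j * c j) := by ring

lemma hasDerivAt_mass (h : memDdensity ρ) (i : Fin I) (u : ℝ) :
    HasDerivAt (mass ρ i) (extZ (ρ i) u) u :=
  (h.continuous_extZ i).integral_hasStrictDerivAt 0 u |>.hasDerivAt

lemma hasDerivAt_phi (h : memDdensity ρ) (i : Fin I) (u : ℝ) :
    HasDerivAt (phi (mass ρ) i) (1 - ∑ j, 2 * min (sz i) (sz j) * extZ (ρ j) u) u := by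
  unfold phi
  exact (hasDerivAt_id u).sub (HasDerivAt.fun_sum fun j _ => (h.hasDerivAt_mass j u).const_mul _)

lemma strictMono_phi (h : memDdensity ρ) (i : Fin I) : StrictMono (phi (mass ρ) i) :=
  strictMono_of_deriv_pos fun u => by
    rw [(h.hasDerivAt_phi i u).deriv]
    exact (h.admissible u).pos i

lemma surjective_phi (h : memDdensity ρ) (i : Fin I) : Function.Surjective (phi (mass ρ) i) := by
  obtain ⟨δ, hδ, hle⟩ := h.exists_slot_density_le
  have hd : ∀ u, HasDerivAt (fun u => phi (mass ρ) i u - δ * u)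
      (1 - ∑ j, 2 * min (sz i) (sz j) * extZ (ρ j) u - δ) u := fun u =>
    (h.hasDerivAt_phi i u).sub (((hasDerivAt_id u).const_mul δ).congr_deriv (mul_one δ))
  have hm : Monotone fun u => phi (mass ρ) i u - δ * u :=
    monotone_of_deriv_nonneg (fun u => (hd u).differentiableAt) fun u => by
      rw [(hd u).deriv]; linarith [hle i u]
  refine Continuous.surjective
    (continuous_iff_continuousAt.2 fun u => (h.hasDerivAt_phi i u).continuousAt) ?_ ?_
  · refine tendsto_atTop_mono' atTop ?_ (tendsto_id.const_mul_atTop hδ)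
    filter_upwards [eventually_ge_atTop 0] with u hu
    have := hm hu
    simp only [phi_mass_zero, id] at this ⊢
    linarith
  · refine tendsto_atBot_mono' atBot ?_ (tendsto_id.const_mul_atBot hδ)
    filter_upwards [eventually_le_atBot 0] with u hu
    have := hm hu
    simp only [phi_mass_zero, id] at this ⊢
    linarith

lemma contDiff_mass (h : memDdensity ρ) (i : Fin I) : ContDiff ℝ 2 (mass ρ i) := by
  rw [show (2 : WithTop ℕ∞) = 1 + 1 from rfl, contDiff_succ_iff_deriv]
  refine ⟨fun u => (h.hasDerivAt_mass i u).differentiableAt, by simp, ?_⟩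
  rw [funext fun u => (h.hasDerivAt_mass i u).deriv]
  exact (h.1 i).2

lemma contDiff_phi (h : memDdensity ρ) (i : Fin I) : ContDiff ℝ 2 (phi (mass ρ) i) := by
  unfold phi
  exact contDiff_id.sub (ContDiff.sum fun j _ => contDiff_const.mul (h.contDiff_mass j))

end memDdensity

lemma mass_of_nonpos {I : ℕ} (ρ : Fin I → ℝ → ℝ) (i : Fin I) {u : ℝ} (hu : u ≤ 0) :
    mass ρ i u = 0 := by
  unfold mass
  rw [intervalIntegral.integral_symm, intervalIntegral.integral_of_le hu,
    MeasureTheory.integral_Ioc_eq_integral_Ioo,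
    MeasureTheory.setIntegral_congr_fun measurableSet_Ioo
      (fun x (hx : x ∈ Ioo u 0) => extZ_of_neg (ρ i) hx.2)]
  simp

/-- A regular scattered configuration: `C²` functions supported on the positive half-line
with slopes between `0` and `c`. -/
structure Profile {I : ℕ} (Ψ : Fin I → ℝ → ℝ) (c : Fin I → ℝ) : Prop where
  contDiff : ∀ i, ContDiff ℝ 2 (Ψ i)
  of_nonpos : ∀ i z, z ≤ 0 → Ψ i z = 0
  deriv_nonneg : ∀ i z, 0 ≤ deriv (Ψ i) z
  deriv_le : ∀ i z, deriv (Ψ i) z ≤ c i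

/-- The free evolution of a profile defined on the whole line. -/
def shift {I : ℕ} (Ψ : Fin I → ℝ → ℝ) (t : ℝ) (i : Fin I) (z : ℝ) : ℝ := Ψ i (z - sz i * t)

namespace Profile

variable {I : ℕ} {Ψ : Fin I → ℝ → ℝ} {c : Fin I → ℝ}

lemma differentiable (h : Profile Ψ c) (i : Fin I) : Differentiable ℝ (Ψ i) :=
  (h.contDiff i).differentiable (by norm_num)

lemma monotone (h : Profile Ψ c) (i : Fin I) : Monotone (Ψ i) :=
  monotone_of_deriv_nonneg (h.differentiable i) (h.deriv_nonneg i)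

lemma nonneg (h : Profile Ψ c) (i : Fin I) (z : ℝ) : 0 ≤ Ψ i z := by
  rcases le_total z 0 with hz | hz
  · exact (h.of_nonpos i z hz).ge
  · rw [← h.of_nonpos i 0 le_rfl]; exact h.monotone i hz

end Profile

/-- The implicit system satisfied by the evolved configuration at the point `(u, t)`. -/
def SolvesSystem {I : ℕ} (Ψ : Fin I → ℝ → ℝ) (u t : ℝ) (x : Fin I → ℝ) : Prop :=
  ∀ i, x i = Ψ i (u - ∑ j, 2 * min (sz i) (sz j) * x j - sz i * t)

lemma SolvesSystem.unique {I : ℕ} {Ψ : Fin I → ℝ → ℝ} (hΨ : ∀ i, Monotone (Ψ i)) {u t : ℝ}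
    {x y : Fin I → ℝ} (hx : SolvesSystem Ψ u t x) (hy : SolvesSystem Ψ u t y) : x = y := by
  have h : (fun i => x i - y i) = 0 := by
    apply eq_zero_of_quad_min_nonpos
    refine Finset.sum_nonpos fun i _ => ?_
    have e : ∑ j, min (sz i) (sz j) * (x j - y j)
        = 1 / 2 * ((u - ∑ j, 2 * min (sz i) (sz j) * y j - sz i * t)
          - (u - ∑ j, 2 * min (sz i) (sz j) * x j - sz i * t)) := by
      have : ∑ j, 2 * min (sz i) (sz j) * x j - ∑ j, 2 * min (sz i) (sz j) * y j
          = 2 * ∑ j, min (sz i) (sz j) * (x j - y j) := by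
        rw [← Finset.sum_sub_distrib, Finset.mul_sum]
        exact Finset.sum_congr rfl fun j _ => by ring
      linear_combination -(1 / 2) * this
    rw [e]
    set a := u - ∑ j, 2 * min (sz i) (sz j) * x j - sz i * t with ha
    set b := u - ∑ j, 2 * min (sz i) (sz j) * y j - sz i * t with hb
    rw [hx i, hy i, ← ha, ← hb]
    rcases le_total a b with hab | hab
    · exact mul_nonpos_of_nonpos_of_nonneg (by linarith [hΨ i hab]) (by linarith)
    · exact mul_nonpos_of_nonneg_of_nonpos (by linarith [hΨ i hab]) (by linarith)
  funext i
  exact sub_eq_zero.1 (congrFun h i)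

/-- The scattered configuration of a regular density is a profile. -/
lemma memDdensity.exists_profile {I : ℕ} {ρ : Fin I → ℝ → ℝ} (h : memDdensity ρ) :
    ∃ (Ψ : Fin I → ℝ → ℝ) (c : Fin I → ℝ), Profile Ψ c ∧
      (∀ i u, Ψ i (phi (mass ρ) i u) = mass ρ i u) ∧ (∀ i, 0 ≤ c i) ∧
      ∑ i, sz i * c i < 1 / 2 := by
  obtain ⟨c, hc0, hc, hc2⟩ := h.exists_const
  choose K hK using h.surjective_phi
  have hΨ : ∀ i u, mass ρ i (K i (phi (mass ρ) i u)) = mass ρ i u := fun i u => by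
    rw [(h.strictMono_phi i).injective (hK i _)]
  have hcd : ∀ i, ContDiff ℝ 2 (K i) := fun i => by
    have := contDiff_implicit (n := 2) (by norm_num) (f := fun p => phi (mass ρ) i p.1)
      ((h.contDiff_phi i).comp contDiff_fst) (fun _ => h.strictMono_phi i)
      (fun p => by
        have := ((h.hasDerivAt_phi i p.1).hasFDerivAt.comp p (hasFDerivAt_fst (𝕜 := ℝ)
          (E := ℝ) (F := ℝ)))
        rw [show (fun p : ℝ × ℝ => phi (mass ρ) i p.1) = phi (mass ρ) i ∘ Prod.fst from rfl,
          this.fderiv]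
        simpa using ((h.admissible p.1).pos i).ne')
      (U := fun y _ => K i y) (fun y _ => hK i y)
    exact this.comp (contDiff_id.prodMk (contDiff_const (c := (0 : ℝ))))
  have hcd' : ∀ i, ContDiff ℝ 2 fun z => mass ρ i (K i z) := fun i =>
    (h.contDiff_mass i).comp (hcd i)
  have hder : ∀ i z, deriv (fun z => mass ρ i (K i z)) z
      * (1 - ∑ j, 2 * min (sz i) (sz j) * extZ (ρ j) (K i z)) = extZ (ρ i) (K i z) := by
    intro i z
    have h1 : HasDerivAt (fun z => mass ρ i (K i z)) (deriv (fun z => mass ρ i (K i z)) z)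
        (phi (mass ρ) i (K i z)) := by
      rw [hK]
      exact ((hcd' i).differentiable (by norm_num) z).hasDerivAt
    have h2 := h1.comp (K i z) (h.hasDerivAt_phi i (K i z))
    rw [show (fun z => mass ρ i (K i z)) ∘ phi (mass ρ) i = mass ρ i from funext (hΨ i)] at h2
    exact h2.unique (h.hasDerivAt_mass i _)
  refine ⟨fun i z => mass ρ i (K i z), c, ⟨hcd', fun i z hz => ?_, fun i z => ?_, fun i z => ?_⟩,
    hΨ, hc0, hc2⟩
  · refine mass_of_nonpos ρ i ((h.strictMono_phi i).le_iff_le.1 ?_)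
    rwa [hK, phi_mass_zero]
  · have : 0 ≤ extZ (ρ i) (K i z) := (h.admissible (K i z)).1 i
    rw [← hder i z] at this
    exact nonneg_of_mul_nonneg_left this ((h.admissible (K i z)).pos i)
  · have := hc i (K i z)
    rw [← hder i z] at this
    exact le_of_mul_le_mul_right this ((h.admissible (K i z)).pos i)

/-- On the whole line, the free evolution of the scattered configuration is a shift. -/
lemma theta_Upsilon_eq_shift {I : ℕ} {ρ : Fin I → ℝ → ℝ} (h : memDdensity ρ)
    {Ψ : Fin I → ℝ → ℝ} {c : Fin I → ℝ} (hΨ : Profile Ψ c)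
    (hΨρ : ∀ i u, Ψ i (phi (mass ρ) i u) = mass ρ i u) {ψ : Fin I → ℝ → ℝ}
    (hψ : ∀ i u, ψ i u = ∫ x in (0:ℝ)..u, ρ i x) (t : ℝ) :
    theta t (Upsilon ψ) = shift Ψ t := by
  have e1 : ∀ i u, 0 ≤ u → ψ i u = mass ρ i u := fun i u hu => by
    rw [hψ, mass, integral_extZ _ hu]
  have e2 : ∀ i u, 0 ≤ u → phi ψ i u = phi (mass ρ) i u := fun i u hu => by
    simp only [phi, e1 _ u hu]
  have e3 : ∀ i z, 0 ≤ z → Upsilon ψ i z = Ψ i z := by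
    intro i z hz
    obtain ⟨a, ha⟩ := h.surjective_phi i z
    have ha0 : 0 ≤ a := by
      rw [← (h.strictMono_phi i).le_iff_le, ha, phi_mass_zero]; exact hz
    have hex : ∃ a ∈ Ici (0:ℝ), phi ψ i a = z := ⟨a, ha0, by rw [e2 i a ha0, ha]⟩
    have hb := Function.invFunOn_mem hex
    have hb2 := Function.invFunOn_eq hex
    change ψ i (Function.invFunOn (phi ψ i) (Ici 0) z) = _
    rw [e1 _ _ hb, ← hΨρ, ← e2 _ _ hb, hb2]
  funext i z
  rw [theta, e3 _ _ (le_max_right _ _), shift]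
  rcases le_total 0 (z - sz i * t) with hz | hz
  · rw [max_eq_left hz]
  · rw [max_eq_right hz, hΨ.of_nonpos i _ hz, hΨ.of_nonpos i _ le_rfl]

lemma hasDerivAt_slice_fst {f : ℝ × ℝ → ℝ} {u t : ℝ} {L : ℝ × ℝ →L[ℝ] ℝ}
    (hf : HasFDerivAt f L (u, t)) : HasDerivAt (fun w => f (w, t)) (L (1, 0)) u :=
  hf.comp_hasDerivAt u ((hasDerivAt_id u).prodMk (hasDerivAt_const u t))

lemma hasDerivAt_slice_snd {f : ℝ × ℝ → ℝ} {u t : ℝ} {L : ℝ × ℝ →L[ℝ] ℝ}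
    (hf : HasFDerivAt f L (u, t)) : HasDerivAt (fun s => f (u, s)) (L (0, 1)) t :=
  hf.comp_hasDerivAt t ((hasDerivAt_const t u).prodMk (hasDerivAt_id t))

lemma gam_apply_zero {I : ℕ} {ψb : Fin I → ℝ → ℝ} (h : ∀ j, ψb j 0 = 0) :
    ∀ i ≤ I, gam ψb i 0 = 0 := by
  refine gam_induction fun i hi ih => ?_
  rw [gam_eq_filter ψb hi, zero_add]
  refine Finset.sum_eq_zero fun j hj => ?_
  rw [ih j (Finset.mem_filter.1 hj).2, h, mul_zero]

theorem Profile.exists_flow {I : ℕ} {Ψ : Fin I → ℝ → ℝ} {c : Fin I → ℝ} (h : Profile Ψ c) :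
    ∃ X : Fin I → ℝ × ℝ → ℝ, (∀ i, ContDiff ℝ 2 (X i)) ∧
      (∀ u t, SolvesSystem Ψ u t fun i => X i (u, t)) ∧
      (∀ (i : Fin I) p, 0 < 1 - ∑ j, 2 * min (sz i) (sz j) * fderiv ℝ (X j) p (1, 0)) ∧
      (∀ p, ∑ j, 2 * sz j * fderiv ℝ (X j) p (1, 0) < 1) ∧
      ∀ i u t, 0 ≤ u → 0 ≤ t → Gamma (shift Ψ t) i u = X i (u, t) := by
  have hθ : ∀ j, ContDiff ℝ 2 fun p : ℝ × ℝ => shift Ψ p.2 j p.1 := fun j =>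
    (h.contDiff j).comp (contDiff_fst.sub (contDiff_const.mul contDiff_snd))
  have hθm : ∀ t j, Monotone (shift Ψ t j) := fun t j z z' hz =>
    h.monotone j (sub_le_sub_right hz _)
  let G : ℕ → ℝ × ℝ → ℝ := fun i p => gam (shift Ψ p.2) i p.1
  have hG : ∀ i ≤ I, ContDiff ℝ 2 (G i) := contDiff_gam hθ
  have hG' : ∀ i ≤ I, ∀ p, HasFDerivAt (G i) (fderiv ℝ (G i) p) p := fun i hi p =>
    ((hG i hi).differentiable (by norm_num) p).hasFDerivAt
  have hGm : ∀ i ≤ I, ∀ t, Monotone fun z => G i (z, t) - z := fun i hi t =>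
    monotone_gam_sub (hθm t) i hi
  have hG1 : ∀ i ≤ I, ∀ p, 1 ≤ fderiv ℝ (G i) p (1, 0) := by
    rintro i hi ⟨u, t⟩
    have h1 := (hasDerivAt_slice_fst (hG' i hi (u, t))).sub (hasDerivAt_id u)
    have h2 := (hGm i hi t).deriv_nonneg (x := u)
    have h3 := h1.deriv
    change deriv (fun z => G i (z, t) - z) u = _ at h3
    linarith
  have hGs : ∀ t, StrictMono fun z => G 0 (z, t) := fun t => by
    have := (hGm 0 (Nat.zero_le _) t).add_strictMono strictMono_id
    simpa using this
  have hGsurj : ∀ t, Function.Surjective fun z => G 0 (z, t) := by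
    intro t
    refine Continuous.surjective ((hG 0 (Nat.zero_le _)).continuous.comp (by fun_prop)) ?_ ?_
    · refine tendsto_atTop_mono' atTop ?_ (tendsto_atTop_add_const_right _ (G 0 (0, t)) tendsto_id)
      filter_upwards [eventually_ge_atTop 0] with z hz
      have := hGm 0 (Nat.zero_le _) t hz
      simp only [id] at this ⊢
      linarith
    · refine tendsto_atBot_mono' atBot ?_ (tendsto_atBot_add_const_right _ (G 0 (0, t)) tendsto_id)
      filter_upwards [eventually_le_atBot 0] with z hz
      have := hGm 0 (Nat.zero_le _) t hz
      simp only [id] at this ⊢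
      linarith
  choose Z' hZ' using hGsurj
  let Z : ℝ → ℝ → ℝ := fun u t => Z' t u
  have hZ : ∀ u t, G 0 (Z u t, t) = u := fun u t => hZ' t u
  have hZd : ContDiff ℝ 2 fun p : ℝ × ℝ => Z p.1 p.2 :=
    contDiff_implicit (by norm_num) (hG 0 (Nat.zero_le _)) hGs
      (fun p => (zero_lt_one.trans_le (hG1 0 (Nat.zero_le _) p)).ne') hZ
  let X : Fin I → ℝ × ℝ → ℝ := fun i p => shift Ψ p.2 i (G ((i : ℕ) + 1) (Z p.1 p.2, p.2))
  have hX : ∀ i, ContDiff ℝ 2 (X i) := fun i =>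
    (hθ i).comp (((hG _ (Nat.succ_le_of_lt i.2)).comp (hZd.prodMk contDiff_snd)).prodMk
      contDiff_snd)
  have hφ : ∀ i : Fin I, ∀ u t, u - ∑ j, 2 * min (sz i) (sz j) * X j (u, t)
      = G ((i : ℕ) + 1) (Z u t, t) := by
    intro i u t
    have := gam_succ_eq (shift Ψ t) i (Z u t)
    rw [show gam (shift Ψ t) 0 (Z u t) = u from hZ u t] at this
    exact this.symm
  have hφ0 : ∀ u t, Z u t + ∑ j, 2 * sz j * X j (u, t) = u := fun u t =>
    (gam_zero_eq (shift Ψ t) (Z u t)).symm.trans (hZ u t)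
  have hX1 : ∀ i u t, HasDerivAt (fun w => X i (w, t)) (fderiv ℝ (X i) (u, t) (1, 0)) u :=
    fun i u t => hasDerivAt_slice_fst ((hX i).differentiable (by norm_num) _).hasFDerivAt
  have hZ1 : ∀ u t, HasDerivAt (fun w => Z w t)
      (fderiv ℝ (fun p : ℝ × ℝ => Z p.1 p.2) (u, t) (1, 0)) u := fun u t =>
    hasDerivAt_slice_fst (hZd.differentiable (by norm_num) (u, t)).hasFDerivAt
  have hGZ : ∀ i ≤ I, ∀ u t, HasDerivAt (fun w => G i (Z w t, t))
      (fderiv ℝ (G i) (Z u t, t) (1, 0)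
        * fderiv ℝ (fun p : ℝ × ℝ => Z p.1 p.2) (u, t) (1, 0)) u := fun i hi u t =>
    (hasDerivAt_slice_fst (hG' i hi (Z u t, t))).comp u (hZ1 u t)
  have hZpos : ∀ u t, 0 < fderiv ℝ (fun p : ℝ × ℝ => Z p.1 p.2) (u, t) (1, 0) := by
    intro u t
    have h1 := hGZ 0 (Nat.zero_le _) u t
    simp only [hZ] at h1
    have h2 := h1.unique (hasDerivAt_id u)
    have h3 := zero_lt_one.trans_le (hG1 0 (Nat.zero_le _) (Z u t, t))
    exact (pos_iff_pos_of_mul_pos (by rw [h2]; exact zero_lt_one)).1 h3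
  refine ⟨X, hX, fun u t i => ?_, ?_, ?_, fun i u t hu ht => ?_⟩
  · change _ = Ψ i (u - ∑ j, 2 * min (sz i) (sz j) * X j (u, t) - sz i * t)
    rw [hφ]
    rfl
  · rintro i ⟨u, t⟩
    have h1 := hGZ _ (Nat.succ_le_of_lt i.2) u t
    simp only [← hφ] at h1
    have h2 := (hasDerivAt_id u).sub (HasDerivAt.fun_sum (u := Finset.univ) fun j _ =>
      (hX1 j u t).const_mul (2 * min (sz i) (sz j)))
    rw [h2.unique h1]
    exact mul_pos (zero_lt_one.trans_le (hG1 _ (Nat.succ_le_of_lt i.2) _)) (hZpos u t)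
  · rintro ⟨u, t⟩
    have h2 := (hZ1 u t).add (HasDerivAt.fun_sum (u := Finset.univ) fun j _ =>
      (hX1 j u t).const_mul (2 * sz j))
    have h3 := h2.unique ((hasDerivAt_id u).congr_of_eventuallyEq
      (Eventually.of_forall fun w => hφ0 w t))
    linarith [hZpos u t]
  · have hz0 : G 0 (0, t) = 0 := gam_apply_zero (ψb := shift Ψ t) (fun j => h.of_nonpos j _ (by
      have := mul_nonneg (sz_pos j).le ht
      linarith)) 0 (Nat.zero_le _)
    have hZ0 : 0 ≤ Z u t := by
      rw [← (hGs t).le_iff_le]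
      simpa only [hz0, hZ] using hu
    have hex : ∃ a ∈ Ici (0:ℝ), gam (shift Ψ t) 0 a = u := ⟨Z u t, hZ0, hZ u t⟩
    have hb2 := Function.invFunOn_eq hex
    have : rinv (gam (shift Ψ t) 0) u = Z u t := (hGs t).injective (hb2.trans (hZ u t).symm)
    change shift Ψ t i (gam (shift Ψ t) ((i : ℕ) + 1) (rinv (gam (shift Ψ t) 0) u)) = _
    rw [this]

/-- The density `∂ᵤ X_i` of a smooth configuration. -/
def density {I : ℕ} (X : Fin I → ℝ × ℝ → ℝ) (i : Fin I) (p : ℝ × ℝ) : ℝ :=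
  fderiv ℝ (X i) p (1, 0)

lemma contDiff_density {I : ℕ} {X : Fin I → ℝ × ℝ → ℝ} (hX : ∀ i, ContDiff ℝ 2 (X i))
    (i : Fin I) : ContDiff ℝ 1 (density X i) :=
  ((hX i).fderiv_right (m := 1) (by norm_num)).clm_apply contDiff_const

lemma hasDerivAt_density {I : ℕ} {X : Fin I → ℝ × ℝ → ℝ} (hX : ∀ i, ContDiff ℝ 2 (X i))
    (i : Fin I) (u t : ℝ) : HasDerivAt (fun w => X i (w, t)) (density X i (u, t)) u :=
  hasDerivAt_slice_fst ((hX i).differentiable (by norm_num) _).hasFDerivAt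

lemma deriv_density_comm {I : ℕ} {X : Fin I → ℝ × ℝ → ℝ} (hX : ∀ i, ContDiff ℝ 2 (X i))
    (i : Fin I) (u t : ℝ) :
    deriv (fun s => density X i (u, s)) t = deriv (fun w => fderiv ℝ (X i) (w, t) (0, 1)) u := by
  have h1 : HasFDerivAt (fderiv ℝ (X i)) (fderiv ℝ (fderiv ℝ (X i)) (u, t)) (u, t) :=
    (((hX i).fderiv_right (m := 1) (by norm_num)).differentiable (by norm_num) _).hasFDerivAt
  have h2 : ∀ v, HasFDerivAt (fun p => fderiv ℝ (X i) p v)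
      ((fderiv ℝ (fderiv ℝ (X i)) (u, t)).flip v) (u, t) := fun v => by
    simpa using h1.clm_apply (hasFDerivAt_const v (u, t))
  have h3 : IsSymmSndFDerivAt ℝ (X i) (u, t) :=
    (hX i).contDiffAt.isSymmSndFDerivAt (by simp)
  have e1 : deriv (fun s => density X i (u, s)) t = _ := (hasDerivAt_slice_snd (h2 (1, 0))).deriv
  have e2 := (hasDerivAt_slice_fst (h2 (0, 1))).deriv
  rw [e1, e2]
  exact h3 _ _

section Flow

variable {I : ℕ} {Ψ : Fin I → ℝ → ℝ} {c : Fin I → ℝ} {X : Fin I → ℝ × ℝ → ℝ}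

lemma density_eq (h : Profile Ψ c) (hX : ∀ i, ContDiff ℝ 2 (X i))
    (hsys : ∀ u t, SolvesSystem Ψ u t fun i => X i (u, t)) (i : Fin I) (u t : ℝ) :
    density X i (u, t)
      = deriv (Ψ i) (u - ∑ j, 2 * min (sz i) (sz j) * X j (u, t) - sz i * t)
        * (1 - ∑ j, 2 * min (sz i) (sz j) * density X j (u, t)) := by
  have h1 := ((hasDerivAt_id u).sub (HasDerivAt.fun_sum (u := Finset.univ) fun j _ =>
    (hasDerivAt_density hX j u t).const_mul (2 * min (sz i) (sz j)))).sub_const (sz i * t)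
  have h2 := HasDerivAt.comp u (h.differentiable i
    (u - ∑ j, 2 * min (sz i) (sz j) * X j (u, t) - sz i * t)).hasDerivAt h1
  refine (hasDerivAt_density hX i u t).unique (h2.congr_of_eventuallyEq ?_)
  exact Eventually.of_forall fun w => hsys w t i

lemma time_deriv_eq (h : Profile Ψ c) (hX : ∀ i, ContDiff ℝ 2 (X i))
    (hsys : ∀ u t, SolvesSystem Ψ u t fun i => X i (u, t)) (i : Fin I) (u t : ℝ) :
    fderiv ℝ (X i) (u, t) (0, 1)
      = deriv (Ψ i) (u - ∑ j, 2 * min (sz i) (sz j) * X j (u, t) - sz i * t)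
        * (-(∑ j, 2 * min (sz i) (sz j) * fderiv ℝ (X j) (u, t) (0, 1)) - sz i) := by
  have h0 : ∀ j, HasDerivAt (fun s => X j (u, s)) (fderiv ℝ (X j) (u, t) (0, 1)) t := fun j =>
    hasDerivAt_slice_snd ((hX j).differentiable (by norm_num) _).hasFDerivAt
  have h1 := ((HasDerivAt.fun_sum (u := Finset.univ) fun j _ =>
    (h0 j).const_mul (2 * min (sz i) (sz j))).const_sub u).sub
    (((hasDerivAt_id t).const_mul (sz i)).congr_deriv (mul_one _))
  have h2 := HasDerivAt.comp t (h.differentiable i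
    (u - ∑ j, 2 * min (sz i) (sz j) * X j (u, t) - sz i * t)).hasDerivAt h1
  refine (h0 i).unique (h2.congr_of_eventuallyEq ?_)
  exact Eventually.of_forall fun s => hsys u s i

lemma density_mem_Icc (h : Profile Ψ c) (hX : ∀ i, ContDiff ℝ 2 (X i))
    (hsys : ∀ u t, SolvesSystem Ψ u t fun i => X i (u, t))
    (hpos : ∀ (i : Fin I) p, 0 < 1 - ∑ j, 2 * min (sz i) (sz j) * density X j p)
    (i : Fin I) (p : ℝ × ℝ) :
    density X i p ∈ Icc 0 (c i * (1 - ∑ j, 2 * min (sz i) (sz j) * density X j p)) := by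
  obtain ⟨u, t⟩ := p
  have := (hpos i (u, t)).le
  rw [density_eq h hX hsys i u t]
  exact ⟨mul_nonneg (h.deriv_nonneg i _) this,
    mul_le_mul_of_nonneg_right (h.deriv_le i _) this⟩

lemma time_deriv_eq_flux (h : Profile Ψ c) (hX : ∀ i, ContDiff ℝ 2 (X i))
    (hsys : ∀ u t, SolvesSystem Ψ u t fun i => X i (u, t))
    (hpos : ∀ (i : Fin I) p, 0 < 1 - ∑ j, 2 * min (sz i) (sz j) * density X j p)
    (hadm : ∀ p, Admissible fun i => density X i p) (i : Fin I) (u t : ℝ) :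
    fderiv ℝ (X i) (u, t) (0, 1)
      = -(veff (fun j => density X j (u, t)) i * density X i (u, t)) := by
  let T : Fin I → ℝ := fun j => fderiv ℝ (X j) (u, t) (0, 1)
  let q : Fin I → ℝ := fun i => 1 - ∑ j, 2 * min (sz i) (sz j) * density X j (u, t)
  let w : Fin I → ℝ := fun i => (sz i + ∑ j, 2 * min (sz i) (sz j) * T j) / q i
  have hqw : ∀ i, q i * w i = sz i + ∑ j, 2 * min (sz i) (sz j) * T j := fun i =>
    mul_div_cancel₀ _ (hpos i (u, t)).ne'
  have hT : ∀ i, density X i (u, t) * w i = -T i := by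
    intro i
    have h1 : T i = _ := time_deriv_eq h hX hsys i u t
    rw [density_eq h hX hsys i u t, mul_assoc, show (1 - ∑ j, 2 * min (sz i) (sz j)
      * density X j (u, t)) * w i = _ from hqw i, h1]
    ring
  have hw : w = veff fun j => density X j (u, t) := by
    refine eq_veff (hadm _) fun i => ?_
    rw [show (1 - ∑ j, 2 * min (sz i) (sz j) * density X j (u, t)) * w i = _ from hqw i]
    simp only [mul_assoc, hT]
    simp
  rw [← hw, mul_comm, hT, neg_neg]

end Flow

lemma hasDerivAt_integral_of_continuous {F k : ℝ × ℝ → ℝ} (hF : Continuous F)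
    (hk : Continuous k) (hd : ∀ x > 0, ∀ s > 0, HasDerivAt (fun s => F (x, s)) (k (x, s)) s)
    {u s : ℝ} (hu : 0 ≤ u) (hs : 0 < s) :
    HasDerivAt (fun s => ∫ x in (0:ℝ)..u, F (x, s)) (∫ x in (0:ℝ)..u, k (x, s)) s := by
  have hFs : ∀ s, Continuous fun x => F (x, s) := fun s => hF.comp (by fun_prop)
  have hks : ∀ s, Continuous fun x => k (x, s) := fun s => hk.comp (by fun_prop)
  obtain ⟨C, hC⟩ := ((isCompact_Icc (a := (0:ℝ)) (b := u)).prod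
    (isCompact_Icc (a := s / 2) (b := 2 * s))).exists_bound_of_continuousOn hk.continuousOn
  refine (intervalIntegral.hasDerivAt_integral_of_dominated_loc_of_deriv_le
    (F := fun s x => F (x, s)) (F' := fun s x => k (x, s)) (bound := fun _ => C)
    (Icc_mem_nhds (by linarith : s / 2 < s) (by linarith : s < 2 * s))
    (Eventually.of_forall fun s => (hFs s).aestronglyMeasurable)
    ((hFs s).intervalIntegrable _ _) (hks s).aestronglyMeasurable
    (Eventually.of_forall fun x hx s' hs' => ?_)
    (continuous_const.intervalIntegrable _ _)
    (Eventually.of_forall fun x hx s' hs' => ?_)).2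
  · rw [uIoc_of_le hu] at hx
    exact hC (x, s') ⟨Ioc_subset_Icc_self hx, hs'⟩
  · rw [uIoc_of_le hu] at hx
    exact hd x hx.1 s' (lt_of_lt_of_le (by linarith) hs'.1)

/-- A classical solution of the conservation-law system whose densities stay admissible. -/
structure IsSolution {I : ℕ} (χ : Fin I → ℝ → ℝ → ℝ) : Prop where
  smooth : ∀ i, memCqTwo 1 (χ i)
  dens : ∀ t ∈ Ici (0:ℝ), memDdensity (fun i u => χ i u t)
  pde : ∀ i, ∀ u ∈ Ici (0:ℝ), ∀ t ∈ Ici (0:ℝ),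
    derivWithin (fun s => χ i u s) (Ici 0) t
      = - derivWithin (fun w => veff (fun j => χ j w t) i * χ i w t) (Ici 0) u

/-- The projection of the plane onto the closed quadrant. -/
def toQuadrant (p : ℝ × ℝ) : ℝ × ℝ := (max p.1 0, max p.2 0)

lemma continuous_toQuadrant : Continuous toQuadrant := by unfold toQuadrant; fun_prop

lemma toQuadrant_mem (p : ℝ × ℝ) : toQuadrant p ∈ Ici (0:ℝ) ×ˢ Ici (0:ℝ) :=
  ⟨mem_Ici.2 (le_max_right _ _), mem_Ici.2 (le_max_right _ _)⟩

lemma toQuadrant_of_pos {x s : ℝ} (hx : 0 < x) (hs : 0 < s) : toQuadrant (x, s) = (x, s) := by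
  simp [toQuadrant, hx.le, hs.le]

namespace IsSolution

variable {I : ℕ} {χ : Fin I → ℝ → ℝ → ℝ}

/-- A solution composed with the projection onto the quadrant. -/
def extend (χ : Fin I → ℝ → ℝ → ℝ) (i : Fin I) (p : ℝ × ℝ) : ℝ :=
  χ i (toQuadrant p).1 (toQuadrant p).2

/-- The mass of a solution, extended to the plane. -/
def extMass (χ : Fin I → ℝ → ℝ → ℝ) (i : Fin I) (u t : ℝ) : ℝ :=
  mass (fun i u => χ i u (max t 0)) i u

/-- The flux of a solution, extended to the plane. -/
def flux (χ : Fin I → ℝ → ℝ → ℝ) (i : Fin I) (p : ℝ × ℝ) : ℝ :=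
  veff (fun j => extend χ j p) i * extend χ i p

lemma dens_max (h : IsSolution χ) (t : ℝ) : memDdensity fun i u => χ i u (max t 0) :=
  h.dens _ (mem_Ici.2 (le_max_right _ _))

lemma extZ_eq_extend (h : IsSolution χ) (i : Fin I) (u t : ℝ) :
    extZ (fun u => χ i u (max t 0)) u = extend χ i (u, t) :=
  (h.dens_max t).extZ_eq_max i u

lemma extMass_eq (h : IsSolution χ) (i : Fin I) (u t : ℝ) :
    extMass χ i u t = ∫ x in (0:ℝ)..u, extend χ i (x, t) := by
  simp only [extMass, mass, h.extZ_eq_extend]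

lemma admissible_extend (h : IsSolution χ) (p : ℝ × ℝ) : Admissible fun i => extend χ i p := by
  have := (h.dens_max p.2).admissible p.1
  simpa only [h.extZ_eq_extend] using this

lemma continuous_extend (h : IsSolution χ) (i : Fin I) : Continuous (extend χ i) :=
  (h.smooth i).2.continuousOn.comp_continuous continuous_toQuadrant toQuadrant_mem

lemma continuous_flux (h : IsSolution χ) (i : Fin I) : Continuous (flux χ i) := by
  refine Continuous.mul (continuous_iff_continuousAt.2 fun p => ?_) (h.continuous_extend i)
  exact ContinuousAt.comp (f := fun p => fun j => extend χ j p)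
    (contDiffAt_veff (h.admissible_extend p) i).continuousAt
    (continuous_pi fun j => h.continuous_extend j).continuousAt

lemma extend_of_nonpos (h : IsSolution χ) (i : Fin I) {u : ℝ} (hu : u ≤ 0) (t : ℝ) :
    extend χ i (u, t) = 0 := by
  have := (h.dens_max t).apply_zero i
  simpa [extend, toQuadrant, hu] using this

/-- The derivative in time of a solution, extended continuously to the plane. -/
def timeDeriv (χ : Fin I → ℝ → ℝ → ℝ) (i : Fin I) (p : ℝ × ℝ) : ℝ :=
  fderivWithin ℝ (fun p : ℝ × ℝ => χ i p.1 p.2) (Ici 0 ×ˢ Ici 0) (toQuadrant p) (0, 1)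

lemma continuous_timeDeriv (h : IsSolution χ) (i : Fin I) : Continuous (timeDeriv χ i) := by
  have h1 := (h.smooth i).2.continuousOn_fderivWithin
    ((uniqueDiffOn_Ici 0).prod (uniqueDiffOn_Ici 0)) le_rfl
  exact (h1.comp_continuous continuous_toQuadrant toQuadrant_mem).clm_apply continuous_const

lemma quadrant_mem_nhds {x s : ℝ} (hx : 0 < x) (hs : 0 < s) :
    Ici (0:ℝ) ×ˢ Ici (0:ℝ) ∈ nhds ((x, s) : ℝ × ℝ) :=
  prod_mem_nhds (Ici_mem_nhds hx) (Ici_mem_nhds hs)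

lemma hasFDerivAt_extend (h : IsSolution χ) (i : Fin I) {x s : ℝ} (hx : 0 < x) (hs : 0 < s) :
    HasFDerivAt (extend χ i) (fderivWithin ℝ (fun p : ℝ × ℝ => χ i p.1 p.2) (Ici 0 ×ˢ Ici 0)
      (toQuadrant (x, s))) (x, s) := by
  have hm := quadrant_mem_nhds hx hs
  rw [toQuadrant_of_pos hx hs]
  have h1 := (((h.smooth i).2.differentiableOn (by norm_num)) (x, s)
    (mem_of_mem_nhds hm)).hasFDerivWithinAt.hasFDerivAt hm
  refine h1.congr_of_eventuallyEq ?_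
  filter_upwards [hm] with p hp
  simp [extend, toQuadrant, mem_Ici.1 hp.1, mem_Ici.1 hp.2]

lemma hasDerivAt_extend_time (h : IsSolution χ) (i : Fin I) {x s : ℝ} (hx : 0 < x) (hs : 0 < s) :
    HasDerivAt (fun s => extend χ i (x, s)) (timeDeriv χ i (x, s)) s :=
  hasDerivAt_slice_snd (h.hasFDerivAt_extend i hx hs)

lemma hasDerivAt_flux (h : IsSolution χ) (i : Fin I) {x s : ℝ} (hx : 0 < x) (hs : 0 < s) :
    HasDerivAt (fun x => flux χ i (x, s)) (-timeDeriv χ i (x, s)) x := by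
  have h1 : ∀ j, DifferentiableAt ℝ (fun x => extend χ j (x, s)) x := fun j =>
    (hasDerivAt_slice_fst (h.hasFDerivAt_extend j hx hs)).differentiableAt
  have h2 : DifferentiableAt ℝ (fun x => flux χ i (x, s)) x := by
    refine DifferentiableAt.mul ?_ (h1 i)
    exact DifferentiableAt.comp x (f := fun x => fun j => extend χ j (x, s))
      (g := fun ρ => veff ρ i)
      ((contDiffAt_veff (h.admissible_extend (x, s)) i).differentiableAt (by norm_num))
      (differentiableAt_pi.2 h1)
  have h3 := h.pde i x hx.le s hs.le
  rw [derivWithin_of_mem_nhds (Ici_mem_nhds hx), derivWithin_of_mem_nhds (Ici_mem_nhds hs)] at h3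
  have e1 : (fun s => χ i x s) =ᶠ[nhds s] fun s => extend χ i (x, s) := by
    filter_upwards [Ioi_mem_nhds hs] with s' hs'
    simp [extend, toQuadrant_of_pos hx hs']
  have e2 : (fun w => veff (fun j => χ j w s) i * χ i w s) =ᶠ[nhds x]
      fun x => flux χ i (x, s) := by
    filter_upwards [Ioi_mem_nhds hx] with x' hx'
    simp [flux, extend, toQuadrant_of_pos hx' hs]
  rw [e1.deriv_eq, e2.deriv_eq, (h.hasDerivAt_extend_time i hx hs).deriv] at h3
  rw [h3, neg_neg]
  exact h2.hasDerivAt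

lemma flux_of_nonpos (h : IsSolution χ) (i : Fin I) {u : ℝ} (hu : u ≤ 0) (t : ℝ) :
    flux χ i (u, t) = 0 := by rw [flux, h.extend_of_nonpos i hu, mul_zero]

lemma hasDerivAt_extMass_space (h : IsSolution χ) (i : Fin I) (u t : ℝ) :
    HasDerivAt (fun u => extMass χ i u t) (extend χ i (u, t)) u := by
  rw [← h.extZ_eq_extend]
  exact (h.dens_max t).hasDerivAt_mass i u

lemma hasDerivAt_extMass_time (h : IsSolution χ) (i : Fin I) (u : ℝ) {s : ℝ} (hs : 0 < s) :
    HasDerivAt (fun s => extMass χ i u s) (-flux χ i (u, s)) s := by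
  rcases le_total u 0 with hu | hu
  · rw [h.flux_of_nonpos i hu, neg_zero]
    simp only [extMass, mass_of_nonpos _ i hu]
    exact hasDerivAt_const _ _
  · simp only [h.extMass_eq]
    refine (hasDerivAt_integral_of_continuous (h.continuous_extend i) (h.continuous_timeDeriv i)
      (fun x hx s hs => h.hasDerivAt_extend_time i hx hs) hu hs).congr_deriv ?_
    have h1 := intervalIntegral.integral_eq_sub_of_hasDerivAt_of_le hu
      ((h.continuous_flux i).comp (g := flux χ i) (f := fun x => (x, s)) (by fun_prop)).continuousOn
      (fun x hx => h.hasDerivAt_flux i hx.1 hs)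
      (((h.continuous_timeDeriv i).comp (f := fun x => (x, s)) (by fun_prop)).neg.intervalIntegrable
        _ _)
    simp only [intervalIntegral.integral_neg, Function.comp_apply, h.flux_of_nonpos i le_rfl,
      sub_zero] at h1
    linarith

lemma hasFDerivAt_extMass (h : IsSolution χ) (i : Fin I) (u : ℝ) {s : ℝ} (hs : 0 < s) :
    HasFDerivAt (fun p : ℝ × ℝ => extMass χ i p.1 p.2)
      ((ContinuousLinearMap.toSpanSingleton ℝ (extend χ i (u, s))).coprod
        (ContinuousLinearMap.toSpanSingleton ℝ (-flux χ i (u, s)))) (u, s) := by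
  have hcont : ∀ {g : ℝ × ℝ → ℝ}, Continuous g →
      Continuous fun p => ContinuousLinearMap.toSpanSingleton ℝ (g p) := fun hg =>
    (ContinuousLinearMap.toSpanSingletonCLE (𝕜 := ℝ) (E := ℝ)).continuous.comp hg
  refine (hasStrictFDerivAt_uncurry_coprod (f := extMass χ i) (u := ((u, s) : ℝ × ℝ))
    (f₁ := fun u s => ContinuousLinearMap.toSpanSingleton ℝ (extend χ i (u, s)))
    (f₂ := fun u s => ContinuousLinearMap.toSpanSingleton ℝ (-flux χ i (u, s)))
    (Eventually.of_forall fun p => (h.hasDerivAt_extMass_space i p.1 p.2).hasFDerivAt) ?_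
    (hcont (h.continuous_extend i)).continuousAt
    (hcont (h.continuous_flux i).neg).continuousAt).hasFDerivAt
  filter_upwards [continuous_snd.continuousAt.eventually (Ioi_mem_nhds hs)] with p hp
  exact (h.hasDerivAt_extMass_time i p.1 hp).hasFDerivAt

lemma continuous_extMass (h : IsSolution χ) (i : Fin I) :
    Continuous fun p : ℝ × ℝ => extMass χ i p.1 p.2 := by
  simp only [h.extMass_eq]
  exact intervalIntegral.continuous_parametric_intervalIntegral_of_continuous
    (f := fun (p : ℝ × ℝ) x => extend χ i (x, p.2))
    ((h.continuous_extend i).comp (by fun_prop)) continuous_fst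

/-- Along the characteristics `φ_i(u, t) - i t = const`, the mass of the `i`-th species is
transported. -/
lemma extMass_transport (h : IsSolution χ) (i : Fin I) (u : ℝ) {t : ℝ} (ht : 0 ≤ t) :
    ∃ v, phi (fun j u => extMass χ j u 0) i v = phi (fun j u => extMass χ j u t) i u - sz i * t ∧
      extMass χ i v 0 = extMass χ i u t := by
  let f : ℝ × ℝ → ℝ := fun p => phi (fun j u => extMass χ j u p.2) i p.1 - sz i * p.2
  have hfc : Continuous f := by
    refine Continuous.sub (continuous_fst.sub ?_) (by fun_prop)
    exact continuous_finsetSum _ fun j _ => (h.continuous_extMass j).const_mul _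
  have hfm : ∀ s, StrictMono fun u => f (u, s) := fun s u u' huu' =>
    sub_lt_sub_right ((h.dens_max s).strictMono_phi i huu') _
  have hfs : ∀ s y, ∃ u, f (u, s) = y := fun s y => by
    obtain ⟨u, hu⟩ := (h.dens_max s).surjective_phi i (y + sz i * s)
    exact ⟨u, by simp only [f]; rw [sub_eq_iff_eq_add]; exact hu⟩
  choose U' hU' using hfs
  let U : ℝ → ℝ → ℝ := fun y s => U' s y
  have hU : ∀ y s, f (U y s, s) = y := fun y s => hU' s y
  have hUc : Continuous fun p : ℝ × ℝ => U p.1 p.2 :=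
    continuous_of_implicit (X := ℝ × ℝ) (f := fun u p => f (u, p.2))
      (hfc.comp (by fun_prop)) (fun p => hfm p.2) (g := fun p => p.1)
      continuous_fst fun p => hU _ _
  set y := f (u, t) with hy
  have hder : ∀ s > 0, HasDerivAt (fun s => extMass χ i (U y s) s) 0 s := by
    intro s hs
    have hm := fun j => h.hasFDerivAt_extMass j (U y s) hs
    have hf := ((hasFDerivAt_fst (𝕜 := ℝ) (p := (U y s, s))).sub
      (HasFDerivAt.fun_sum (u := Finset.univ) fun j _ =>
        (hm j).const_mul (2 * min (sz i) (sz j)))).sub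
      ((hasFDerivAt_snd (𝕜 := ℝ) (p := (U y s, s))).const_mul (sz i))
    have hadm := h.admissible_extend (U y s, s)
    have hq := hadm.pos i
    have hL1 := hasDerivAt_implicit (f := f) hU hUc hf (by
      simpa using hq.ne')
    have hv := veff_spec hadm i
    have hL2 : HasDerivAt (fun s => U y s) (veff (fun j => extend χ j (U y s, s)) i) s := by
      refine hL1.congr_deriv ?_
      rw [div_eq_iff (by simpa using hq.ne')]
      have : ∑ j, 2 * min (sz i) (sz j) * flux χ j (U y s, s)
          = ∑ j, 2 * min (sz i) (sz j) * extend χ j (U y s, s)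
            * veff (fun j => extend χ j (U y s, s)) j :=
        Finset.sum_congr rfl fun j _ => by rw [flux]; ring
      simp [this]
      linarith
    have hcurve : HasDerivAt (fun s => ((U y s, s) : ℝ × ℝ))
        (veff (fun j => extend χ j (U y s, s)) i, 1) s := hL2.prodMk (hasDerivAt_id s)
    have h4 := (hm i).comp_hasDerivAt s (f := fun s => ((U y s, s) : ℝ × ℝ)) hcurve
    refine h4.congr_deriv ?_
    simp [flux]
  have hcont : Continuous fun s => extMass χ i (U y s) s :=
    (h.continuous_extMass i).comp (f := fun s => (U y s, s))
      ((hUc.comp (f := fun s => (y, s)) (by fun_prop)).prodMk continuous_id)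
  have hUt : U y t = u := (hfm t).injective (hU y t)
  refine ⟨U y 0, ?_, ?_⟩
  · simpa [f] using hU y 0
  · rcases ht.eq_or_lt with rfl | ht
    · rw [hUt]
    · obtain ⟨c, _, hc⟩ := exists_hasDerivAt_eq_slope _ (fun _ => 0) ht hcont.continuousOn
        fun s hs => hder s hs.1
      rw [eq_div_iff (sub_pos.2 ht).ne', zero_mul, hUt] at hc
      linarith

variable {ρ0 : Fin I → ℝ → ℝ}

lemma extMass_zero_right (h0 : ∀ i, ∀ u ∈ Ici (0:ℝ), χ i u 0 = ρ0 i u) (i : Fin I) (u : ℝ) :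
    extMass χ i u 0 = mass ρ0 i u := by
  have : extZ (fun u => χ i u (max 0 0)) = extZ (ρ0 i) := by
    funext x
    rcases le_or_gt 0 x with hx | hx
    · rw [extZ_of_nonneg _ hx, extZ_of_nonneg _ hx, max_self, h0 i x hx]
    · rw [extZ_of_neg _ hx, extZ_of_neg _ hx]
  simp only [extMass, mass, this]

/-- The mass of every solution solves the implicit system of the free evolution. -/
lemma extMass_solvesSystem (h : IsSolution χ) (h0 : ∀ i, ∀ u ∈ Ici (0:ℝ), χ i u 0 = ρ0 i u)
    {Ψ : Fin I → ℝ → ℝ} (hΨρ : ∀ i u, Ψ i (phi (mass ρ0) i u) = mass ρ0 i u) (u : ℝ) {t : ℝ}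
    (ht : 0 ≤ t) : SolvesSystem Ψ u t fun i => extMass χ i u t := by
  intro i
  obtain ⟨v, hv1, hv2⟩ := h.extMass_transport i u ht
  have e : (fun j u => extMass χ j u 0) = mass ρ0 :=
    funext fun j => funext fun u => extMass_zero_right h0 j u
  rw [e] at hv1
  rw [extMass_zero_right h0, ← hΨρ, hv1] at hv2
  exact hv2.symm

end IsSolution

section Flow

variable {I : ℕ} {Ψ : Fin I → ℝ → ℝ} {c : Fin I → ℝ} {X : Fin I → ℝ × ℝ → ℝ}

lemma SolvesSystem.nonneg (h : Profile Ψ c) {u t : ℝ} {x : Fin I → ℝ}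
    (hx : SolvesSystem Ψ u t x) (i : Fin I) : 0 ≤ x i := by
  rw [hx i]
  exact h.nonneg i _

lemma density_of_neg (h : Profile Ψ c) (hX : ∀ i, ContDiff ℝ 2 (X i))
    (hsys : ∀ u t, SolvesSystem Ψ u t fun i => X i (u, t)) (i : Fin I) {u t : ℝ} (hu : u < 0)
    (ht : 0 ≤ t) : density X i (u, t) = 0 := by
  refine (hasDerivAt_density hX i u t).unique ((hasDerivAt_const u 0).congr_of_eventuallyEq ?_)
  filter_upwards [Iio_mem_nhds hu] with w hw
  have h0 : SolvesSystem Ψ w t fun _ => 0 := fun j => by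
    have := mul_nonneg (sz_pos j).le ht
    rw [h.of_nonpos j _ (by simp; linarith [mem_Iio.1 hw])]
  exact congrFun ((hsys w t).unique h.monotone h0) i

lemma extZ_density (h : Profile Ψ c) (hX : ∀ i, ContDiff ℝ 2 (X i))
    (hsys : ∀ u t, SolvesSystem Ψ u t fun i => X i (u, t)) (i : Fin I) {t : ℝ} (ht : 0 ≤ t)
    {f : ℝ → ℝ} (hf : ∀ u, 0 ≤ u → f u = density X i (u, t)) :
    extZ f = fun u => density X i (u, t) := by
  funext u
  rcases le_or_gt 0 u with hu | hu
  · rw [extZ_of_nonneg _ hu, hf u hu]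
  · rw [extZ_of_neg _ hu, density_of_neg h hX hsys i hu ht]

lemma density_zero_right {ρ0 : Fin I → ℝ → ℝ} (hρ0 : memDdensity ρ0) (h : Profile Ψ c)
    (hΨρ : ∀ i u, Ψ i (phi (mass ρ0) i u) = mass ρ0 i u) (hX : ∀ i, ContDiff ℝ 2 (X i))
    (hsys : ∀ u t, SolvesSystem Ψ u t fun i => X i (u, t)) (i : Fin I) {u : ℝ} (hu : 0 ≤ u) :
    density X i (u, 0) = ρ0 i u := by
  rw [← extZ_of_nonneg (ρ0 i) hu]
  refine (hasDerivAt_density hX i u 0).unique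
    ((hρ0.hasDerivAt_mass i u).congr_of_eventuallyEq (Eventually.of_forall fun w => ?_))
  have h0 : SolvesSystem Ψ w 0 fun j => mass ρ0 j w := fun j => by
    rw [mul_zero, sub_zero]
    exact (hΨρ j w).symm
  exact congrFun ((hsys w 0).unique h.monotone h0) i

lemma IsSolution.eq_density {χ : Fin I → ℝ → ℝ → ℝ} (hχ : IsSolution χ)
    {ρ0 : Fin I → ℝ → ℝ} (h0 : ∀ i, ∀ u ∈ Ici (0:ℝ), χ i u 0 = ρ0 i u) (h : Profile Ψ c)
    (hΨρ : ∀ i u, Ψ i (phi (mass ρ0) i u) = mass ρ0 i u) (hX : ∀ i, ContDiff ℝ 2 (X i))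
    (hsys : ∀ u t, SolvesSystem Ψ u t fun i => X i (u, t)) (i : Fin I) {u t : ℝ} (hu : 0 ≤ u)
    (ht : 0 ≤ t) : χ i u t = density X i (u, t) := by
  have e : χ i u t = IsSolution.extend χ i (u, t) := by simp [IsSolution.extend, toQuadrant, hu, ht]
  rw [e]
  refine (hχ.hasDerivAt_extMass_space i u t).unique
    ((hasDerivAt_density hX i u t).congr_of_eventuallyEq (Eventually.of_forall fun w => ?_))
  exact congrFun ((hχ.extMass_solvesSystem h0 hΨρ w ht).unique h.monotone (hsys w t)) i

end Flow

/-- for `ρ0 ∈ 𝒟_density`, `ψ0_i(u) := ∫_0^u ρ0_i`, the flow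
`ψ(u,t) := (Υ⁻¹ ∘ θ_t ∘ Υ(ψ0))(u)` (with `Υ⁻¹ = Γ`) and `ρ_i(u,t) := ∂_u ψ_i(u,t)`:
each `ψ_i ∈ C²(ℝ₊²,ℝ₊)`, each `ρ_i ∈ C¹(ℝ₊²,ℝ₊)`, `ρ(·,t) ∈ 𝒟_density` for all
`t ≥ 0`, `ρ` solves `∂_t ρ_i = -∂_u (v_i^eff(ρ) ρ_i)` on `ℝ₊²` with `ρ(·,0) = ρ0`,
and `ρ` is the unique such solution in the class of `χ` with components in
`C¹(ℝ₊²,ℝ₊)` and `χ(·,t) ∈ 𝒟_density` for all `t ≥ 0`. -/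
theorem stmt_19 {I : ℕ} (hI : 1 ≤ I) (ρ0 : Fin I → ℝ → ℝ) (hρ0 : memDdensity ρ0)
    (ψ0 : Fin I → ℝ → ℝ)
    (hψ0 : ∀ i u, ψ0 i u = ∫ x in (0:ℝ)..u, ρ0 i x)
    (ψ : Fin I → ℝ → ℝ → ℝ)
    (hψ : ∀ i u t, ψ i u t = Gamma (theta t (Upsilon ψ0)) i u)
    (ρ : Fin I → ℝ → ℝ → ℝ)
    (hρ : ∀ i u t, ρ i u t = derivWithin (fun w => ψ i w t) (Ici 0) u) :
    (∀ i, memCqTwo 2 (ψ i)) ∧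
    (∀ i, memCqTwo 1 (ρ i)) ∧
    (∀ t ∈ Ici (0:ℝ), memDdensity (fun i u => ρ i u t)) ∧
    (∀ i, ∀ u ∈ Ici (0:ℝ), ∀ t ∈ Ici (0:ℝ),
      derivWithin (fun s => ρ i u s) (Ici 0) t
        = - derivWithin (fun w => veff (fun j => ρ j w t) i * ρ i w t) (Ici 0) u) ∧
    (∀ i, ∀ u ∈ Ici (0:ℝ), ρ i u 0 = ρ0 i u) ∧
    (∀ χ : Fin I → ℝ → ℝ → ℝ,
      (∀ i, memCqTwo 1 (χ i)) →
      (∀ t ∈ Ici (0:ℝ), memDdensity (fun i u => χ i u t)) →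
      (∀ i, ∀ u ∈ Ici (0:ℝ), ∀ t ∈ Ici (0:ℝ),
        derivWithin (fun s => χ i u s) (Ici 0) t
          = - derivWithin (fun w => veff (fun j => χ j w t) i * χ i w t) (Ici 0) u) →
      (∀ i, ∀ u ∈ Ici (0:ℝ), χ i u 0 = ρ0 i u) →
      ∀ i, ∀ u ∈ Ici (0:ℝ), ∀ t ∈ Ici (0:ℝ), χ i u t = ρ i u t) := by
  obtain ⟨Ψ, c, hΨ, hΨρ, -, hc⟩ := hρ0.exists_profile
  obtain ⟨X, hX, hsys, hpos, hlt, hGamma⟩ := hΨ.exists_flow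
  have hψX : ∀ i u t, 0 ≤ u → 0 ≤ t → ψ i u t = X i (u, t) := fun i u t hu ht => by
    rw [hψ, theta_Upsilon_eq_shift hρ0 hΨ hΨρ hψ0, hGamma i u t hu ht]
  have hρX : ∀ i u t, 0 ≤ u → 0 ≤ t → ρ i u t = density X i (u, t) := fun i u t hu ht => by
    rw [hρ, derivWithin_congr (s := Ici 0) (fun w hw => hψX i w t hw ht) (hψX i u t hu ht)]
    exact (hasDerivAt_density hX i u t).hasDerivWithinAt.derivWithin (uniqueDiffOn_Ici 0 u hu)
  have hbound := density_mem_Icc hΨ hX hsys hpos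
  have hadm : ∀ p, Admissible fun i => density X i p := fun p =>
    ⟨fun i => (hbound i p).1, hlt p⟩
  have hflux := time_deriv_eq_flux hΨ hX hsys hpos hadm
  refine ⟨fun i => ⟨fun u hu t ht => ?_, ?_⟩, fun i => ⟨fun u hu t ht => ?_, ?_⟩,
    fun t ht => ⟨fun i => ⟨fun u hu => ?_, ?_⟩, fun u hu => ?_, c, fun i u hu => ?_, hc⟩,
    fun i u hu t ht => ?_, fun i u hu => ?_, fun χ h1 h2 h3 h4 i u hu t ht => ?_⟩
  · rw [hψX i u t hu ht]
    exact (hsys u t).nonneg hΨ i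
  · exact (hX i).contDiffOn.congr fun p hp => hψX i p.1 p.2 hp.1 hp.2
  · rw [hρX i u t hu ht]
    exact (hbound i _).1
  · exact (contDiff_density hX i).contDiffOn.congr fun p hp => hρX i p.1 p.2 hp.1 hp.2
  · exact (hρX i u t hu ht).ge.trans' (hbound i _).1
  · rw [extZ_density hΨ hX hsys i ht fun u hu => hρX i u t hu ht]
    exact (contDiff_density hX i).comp (contDiff_prodMk_left t)
  · simp only [hρX _ u t hu ht]
    exact hlt _
  · simp only [hρX _ u t hu ht]
    exact (hbound i _).2
  · have hd1 : ContDiff ℝ 1 fun s => density X i (u, s) :=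
      (contDiff_density hX i).comp (contDiff_prodMk_right u)
    have hd2 : ContDiff ℝ 1 fun w => fderiv ℝ (X i) (w, t) (0, 1) :=
      (((hX i).fderiv_right (m := 1) (by norm_num)).comp (contDiff_prodMk_left t)).clm_apply
        contDiff_const
    have e : ∀ w ∈ Ici (0:ℝ), veff (fun j => ρ j w t) i * ρ i w t
        = -fderiv ℝ (X i) (w, t) (0, 1) := fun w hw => by
      simp only [hρX _ w t hw ht, hflux, neg_neg]
    rw [derivWithin_congr e (e u hu), derivWithin_congr (s := Ici 0)
      (fun s hs => hρX i u s hu hs) (hρX i u t hu ht), (hd1.differentiable (by norm_num) t).derivWithin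
      (uniqueDiffOn_Ici 0 t ht), (hd2.neg.differentiable (by norm_num) u).derivWithin
      (uniqueDiffOn_Ici 0 u hu), deriv_density_comm hX, deriv.fun_neg, neg_neg]
  · rw [hρX i u 0 hu le_rfl]
    exact density_zero_right hρ0 hΨ hΨρ hX hsys i hu
  · rw [hρX i u t hu ht]
    exact IsSolution.eq_density ⟨h1, h2, h3⟩ h4 hΨ hΨρ hX hsys i hu ht
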